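/- Assume the ALAVI setting, that G is monotone on U (⟨G(u) − G(v), u − v⟩ ≥ 0 for all u, v ∈ U), and that r > 0 satisfies ‖uᵏ‖ ≤ r and ‖qᵏ‖ ≤ r for all k ≥ 1. For every integer t ≥ 1 define the ergodic averages ũ_t = (1/t)∑_{k=1}^{t} uᵏ and p̃_t = (1/t)∑_{k=1}^{t} qᵏ. Then there exists ρ̃ > 0 such that ψ(ũ_t, p̃_t) ≤ ρ̃/t for all t ≥ 1. -/

import Mathlib

open RealInnerProductSpace

section ProximalInequalities

variable {E F : Type*} [NormedAddCommGroup E] [InnerProductSpace ℝ E]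
  [NormedAddCommGroup F] [InnerProductSpace ℝ F]

lemma nonpos_of_forall_le_mul {a b : ℝ} (h : ∀ s : ℝ, 0 < s → s < 1 → a ≤ s * b) : a ≤ 0 := by
  by_contra! ha
  have hb := abs_nonneg b
  have hs := h (a / (2 * (a + |b|))) (by positivity)
    (by rw [div_lt_one (by positivity)]; linarith)
  have hs' : a / (2 * (a + |b|)) * b ≤ a / (2 * (a + |b|)) * |b| :=
    mul_le_mul_of_nonneg_left (le_abs_self b) (by positivity)
  have : a / (2 * (a + |b|)) * |b| ≤ a / 2 := by
    rw [div_mul_eq_mul_div, div_le_div_iff₀ (by positivity) (by positivity)]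
    nlinarith
  linarith

lemma norm_sq_convex_combination (x y z : E) (s : ℝ) :
    ‖(1 - s) • x + s • y - z‖ ^ 2 =
      (1 - s) * ‖x - z‖ ^ 2 + s * ‖y - z‖ ^ 2 - s * (1 - s) * ‖y - x‖ ^ 2 := by
  have h1 : (1 - s) • x + s • y - z = (1 - s) • (x - z) + s • (y - z) := by module
  have h2 : y - x = (y - z) - (x - z) := by abel
  rw [h1, h2, norm_add_sq_real, norm_sub_sq_real (y - z) (x - z), norm_smul, norm_smul, inner_smul_left,
    inner_smul_right, real_inner_comm (x - z) (y - z), mul_pow, mul_pow, Real.norm_eq_abs,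
    Real.norm_eq_abs, sq_abs, sq_abs]
  simp only [conj_trivial]
  ring

/-- The three-point inequality for a minimizer of `f + c ‖· - v‖ ^ 2` over a convex set. -/
lemma ConvexOn.three_point_inequality {U : Set E} {f : E → ℝ} (hf : ConvexOn ℝ U f) {c : ℝ}
    {w v : E} (hw : w ∈ U)
    (hmin : ∀ x ∈ U, f w + c * ‖w - v‖ ^ 2 ≤ f x + c * ‖x - v‖ ^ 2) {x : E} (hx : x ∈ U) :
    f w - f x ≤ c * (‖x - v‖ ^ 2 - ‖w - v‖ ^ 2 - ‖x - w‖ ^ 2) := by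
  rw [← sub_nonpos]
  refine nonpos_of_forall_le_mul (b := c * ‖x - w‖ ^ 2) fun s hs0 hs1 => ?_
  have hz := hmin _ (hf.1 hw hx (by linarith : 0 ≤ 1 - s) hs0.le (by ring))
  have hc := hf.2 hw hx (by linarith : 0 ≤ 1 - s) hs0.le (by ring)
  rw [norm_sq_convex_combination] at hz
  simp only [smul_eq_mul] at hc
  refine le_of_mul_le_mul_left ?_ hs0
  linarith

lemma inner_sub_sub_eq_norm_sq (x y z : E) :
    ⟪x - y, z - x⟫ = (‖z - y‖ ^ 2 - ‖z - x‖ ^ 2 - ‖x - y‖ ^ 2) / 2 := by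
  have h : z - y = (z - x) + (x - y) := by abel
  rw [h, norm_add_sq_real, real_inner_comm]
  ring

lemma norm_sub_le_of_variational_inequality {K : Set F} {P : F → F}
    (hP : ∀ x, P x ∈ K ∧ ∀ y ∈ K, ⟪x - P x, y - P x⟫ ≤ 0) (x y : F) :
    ‖P x - P y‖ ≤ ‖x - y‖ := by
  have h1 := (hP x).2 _ (hP y).1
  have h2 := (hP y).2 _ (hP x).1
  have h3 : ⟪x - P x, P y - P x⟫ + ⟪y - P y, P x - P y⟫ =
      ‖P x - P y‖ ^ 2 - ⟪x - y, P x - P y⟫ := by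
    rw [← real_inner_self_eq_norm_sq, ← neg_sub (P x) (P y), inner_neg_right, ← sub_eq_neg_add,
      ← inner_sub_left, ← inner_sub_left]
    congr 1
    abel
  have h4 := real_inner_le_norm (x - y) (P x - P y)
  by_contra! h
  nlinarith [norm_nonneg (x - y), norm_nonneg (P x - P y)]

/-- Dual step: `p = P (p₀ + γ a)` and `q = P (p + γ a)`, tested against `l`. -/
lemma dual_step_inequality {K : Set F} {P : F → F}
    (hP : ∀ x, P x ∈ K ∧ ∀ y ∈ K, ⟪x - P x, y - P x⟫ ≤ 0) {γ : ℝ} {p₀ p q a l : F}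
    (hl : l ∈ K) (hp : p = P (p₀ + γ • a)) (hq : q = P (p + γ • a)) :
    γ * ⟪l - q, a⟫ ≤ (‖l - p₀‖ ^ 2 - ‖l - p‖ ^ 2) / 2 - ‖p - q‖ ^ 2 := by
  have h1 := (hP (p₀ + γ • a)).2 l hl
  have h2 := (hP (p + γ • a)).2 p (hp ▸ (hP _).1)
  rw [← hp] at h1
  rw [← hq] at h2
  have e1 : ⟪p₀ + γ • a - p, l - p⟫ = γ * ⟪l - p, a⟫ - ⟪p - p₀, l - p⟫ := by
    rw [show p₀ + γ • a - p = γ • a - (p - p₀) by abel, inner_sub_left, real_inner_smul_left,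
      real_inner_comm]
  have e2 : ⟪p + γ • a - q, p - q⟫ = γ * ⟪p - q, a⟫ + ‖p - q‖ ^ 2 := by
    rw [show p + γ • a - q = γ • a + (p - q) by abel, inner_add_left, real_inner_smul_left,
      real_inner_comm, real_inner_self_eq_norm_sq]
  have e3 : ⟪l - q, a⟫ = ⟪l - p, a⟫ + ⟪p - q, a⟫ := by
    rw [← inner_add_left]; congr 1; abel
  rw [e1, inner_sub_sub_eq_norm_sq] at h1
  rw [e2] at h2
  rw [e3]
  nlinarith [sq_nonneg ‖p - p₀‖]

/-- Primal distance bookkeeping for two successive extrapolated proximal steps. -/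
lemma golden_ratio_step_inequality {η : ℝ} (hη0 : 0 < η) (hη1 : η < 1) (hη : 1 ≤ η ^ 2 + η)
    {x u₁ u₂ v₀ v₁ v₂ : E} (hv1 : v₁ = (1 - η) • u₁ + η • v₀)
    (hv2 : v₂ = (1 - η) • u₂ + η • v₁) :
    (‖x - v₁‖ ^ 2 - ‖u₂ - v₁‖ ^ 2 - ‖x - u₂‖ ^ 2) +
        (‖u₂ - v₀‖ ^ 2 - ‖u₁ - v₀‖ ^ 2 - ‖u₂ - u₁‖ ^ 2) ≤
      (‖x - v₁‖ ^ 2 - ‖x - v₂‖ ^ 2) / (1 - η) - ‖u₂ - u₁‖ ^ 2 / η := by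
  have h1 : ‖u₂ - v₁‖ ^ 2 =
      (1 - η) * ‖u₂ - u₁‖ ^ 2 + η * ‖u₂ - v₀‖ ^ 2 - η * (1 - η) * ‖u₁ - v₀‖ ^ 2 := by
    have := norm_sq_convex_combination u₁ v₀ u₂ η
    rw [← hv1] at this
    rw [norm_sub_rev u₂ v₁, this, norm_sub_rev u₁ u₂, norm_sub_rev v₀ u₂, norm_sub_rev v₀ u₁]
  have h2 : ‖x - v₂‖ ^ 2 =
      (1 - η) * ‖x - u₂‖ ^ 2 + η * ‖x - v₁‖ ^ 2 - η * (1 - η) * ‖u₂ - v₁‖ ^ 2 := by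
    have := norm_sq_convex_combination u₂ v₁ x η
    rw [← hv2] at this
    rw [norm_sub_rev x v₂, this, norm_sub_rev u₂ x, norm_sub_rev v₁ x, norm_sub_rev v₁ u₂]
  have h3 : (‖x - v₁‖ ^ 2 - ‖x - v₂‖ ^ 2) / (1 - η) =
      ‖x - v₁‖ ^ 2 - ‖x - u₂‖ ^ 2 + η * ‖u₂ - v₁‖ ^ 2 := by
    rw [h2]
    field_simp [(by linarith : (1 - η) ≠ 0)]
    ring
  have h4 : 0 ≤ (η ^ 2 + η - 1) * ‖u₂ - v₁‖ ^ 2 := mul_nonneg (by linarith) (sq_nonneg _)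
  have h6 : 0 ≤ η * (1 - η) * ‖u₁ - v₀‖ ^ 2 * η :=
    mul_nonneg (mul_nonneg (mul_nonneg hη0.le (by linarith)) (sq_nonneg _)) hη0.le
  have h5 : ‖u₂ - u₁‖ ^ 2 / η * η = ‖u₂ - u₁‖ ^ 2 := div_mul_cancel₀ _ hη0.ne'
  rw [h3]
  refine le_of_mul_le_mul_left ?_ hη0
  nlinarith

/-- Absorption of the coupling terms into the step-size budget. -/
lemma coupling_terms_le {γ τ L a b d s e : ℝ} (hγ : 0 < γ) (hτ : 0 < τ) (hL : 0 ≤ L)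
    (hγτ : γ * τ ≤ 1)
    (hs : s ≤ (d + γ * τ * a) * (τ * b)) (he : e ≤ L * a * b) :
    s + e ≤ d ^ 2 / γ + (γ * τ ^ 2 + L + τ) * b ^ 2 +
      (γ * τ ^ 2 + L) / 2 * (a ^ 2 - b ^ 2) := by
  have h1 : d * (τ * b) ≤ d ^ 2 / γ + γ * τ ^ 2 / 4 * b ^ 2 := by
    have : d ^ 2 / γ + γ * τ ^ 2 / 4 * b ^ 2 - d * (τ * b) = (d - γ * τ * b / 2) ^ 2 / γ := by
      field_simp; ring
    have h0 : 0 ≤ (d - γ * τ * b / 2) ^ 2 / γ := by positivity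
    linarith
  have h2 : (γ * τ ^ 2 + L) * (a * b) ≤ (γ * τ ^ 2 + L) * ((a ^ 2 + b ^ 2) / 2) :=
    mul_le_mul_of_nonneg_left (by nlinarith [sq_nonneg (a - b)]) (by positivity)
  have h3 : γ * τ ^ 2 / 4 * b ^ 2 ≤ τ * b ^ 2 := by
    apply mul_le_mul_of_nonneg_right _ (sq_nonneg b)
    nlinarith
  nlinarith

lemma convexOn_inner_of_cone_convex {C : Set F} {Θ : E → F}
    (hΘ : ∀ x y : E, ∀ a : ℝ, a ∈ Set.Icc (0 : ℝ) 1 →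
      Θ (a • x + (1 - a) • y) - a • Θ x - (1 - a) • Θ y ∈ -C)
    {l : F} (hl : ∀ c ∈ C, 0 ≤ ⟪l, c⟫) : ConvexOn ℝ Set.univ fun x => ⟪l, Θ x⟫ := by
  refine ⟨convex_univ, fun x _ y _ a b ha hb hab => ?_⟩
  obtain rfl : b = 1 - a := by linarith
  have h := hl _ (hΘ x y a ⟨ha, by linarith⟩)
  rw [inner_neg_right, inner_sub_right, inner_sub_right, real_inner_smul_right,
    real_inner_smul_right] at h
  simp only [smul_eq_mul]
  linarith

lemma ConvexOn.map_Icc_average_le {f : E → ℝ} (hf : ConvexOn ℝ Set.univ f) (u : ℕ → E) {t : ℕ}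
    (ht : 1 ≤ t) :
    f ((t : ℝ)⁻¹ • ∑ k ∈ Finset.Icc 1 t, u k) ≤ (t : ℝ)⁻¹ * ∑ k ∈ Finset.Icc 1 t, f (u k) := by
  have ht0 : (t : ℝ) ≠ 0 := by positivity
  have := hf.map_sum_le (t := Finset.Icc 1 t) (w := fun _ => (t : ℝ)⁻¹) (p := u)
    (fun _ _ => by positivity) (by simp [ht0]) (fun _ _ => Set.mem_univ _)
  rwa [← Finset.smul_sum, ← Finset.smul_sum, smul_eq_mul] at this

lemma sum_Icc_le_of_le_sub {f e : ℕ → ℝ} (h : ∀ k, f (k + 1) ≤ e k - e (k + 1))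
    (he : ∀ k, 0 ≤ e k) (t : ℕ) : ∑ k ∈ Finset.Icc 1 t, f k ≤ e 0 := by
  suffices ∑ k ∈ Finset.Icc 1 t, f k ≤ e 0 - e t by linarith [he t]
  induction t with
  | zero => simp
  | succ t ih =>
    rw [Finset.sum_Icc_succ_top (by omega)]
    linarith [h t]

end ProximalInequalities



theorem stmt19 (n m : ℕ)
    (U : Set (EuclideanSpace ℝ (Fin n)))
    (hUne : U.Nonempty) (hUcl : IsClosed U) (hUcx : Convex ℝ U)
    (C : Set (EuclideanSpace ℝ (Fin m)))
    (hCne : C.Nonempty) (hCcl : IsClosed C) (hCcx : Convex ℝ C)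
    (hCcone : ∀ c ∈ C, ∀ t : ℝ, 0 < t → t • c ∈ C)
    (Cstar : Set (EuclideanSpace ℝ (Fin m)))
    (hCstar : Cstar = {p | ∀ c ∈ C, 0 ≤ ⟪p, c⟫})
    (G : EuclideanSpace ℝ (Fin n) → EuclideanSpace ℝ (Fin n)) (hG : Continuous G)
    (J : EuclideanSpace ℝ (Fin n) → ℝ) (hJ : ConvexOn ℝ Set.univ J)
    (Θ : EuclideanSpace ℝ (Fin n) → EuclideanSpace ℝ (Fin m)) (hΘc : Continuous Θ)
    (hΘcx : ∀ x y : EuclideanSpace ℝ (Fin n), ∀ a : ℝ, a ∈ Set.Icc (0 : ℝ) 1 →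
      Θ (a • x + (1 - a) • y) - a • Θ x - (1 - a) • Θ y ∈ -C)
    (Pi : EuclideanSpace ℝ (Fin m) → EuclideanSpace ℝ (Fin m))
    (hPi : ∀ x, Pi x ∈ Cstar ∧ ∀ y ∈ Cstar, ⟪x - Pi x, y - Pi x⟫ ≤ 0)
    (L τ η γ α : ℝ) (hL : 0 ≤ L) (hτ : 0 < τ)
    (hGLip : ∀ x ∈ U, ∀ y ∈ U, ‖G x - G y‖ ≤ L * ‖x - y‖)
    (hΘLip : ∀ x y : EuclideanSpace ℝ (Fin n), ‖Θ x - Θ y‖ ≤ τ * ‖x - y‖)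
    (hη₁ : (Real.sqrt 5 - 1) / 2 ≤ η) (hη₂ : η < 1)
    (hγ₁ : 0 < γ) (hγ₂ : γ < 1 / τ)
    (hα₁ : 0 < α) (hα₂ : α ≤ 1 / (2 * (γ * τ ^ 2 + L + τ) * η))
    (u v : ℕ → EuclideanSpace ℝ (Fin n)) (p q : ℕ → EuclideanSpace ℝ (Fin m))
    (hu0 : u 0 ∈ U)
    (hq : ∀ k, q k = Pi (p k + γ • Θ (u k)))
    (huU : ∀ k, u (k + 1) ∈ U)
    (humin : ∀ k, ∀ x ∈ U,
      ⟪G (u k), u (k + 1)⟫ + J (u (k + 1)) + ⟪q k, Θ (u (k + 1))⟫ +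
          ‖u (k + 1) - v k‖ ^ 2 / (2 * α) ≤
        ⟪G (u k), x⟫ + J x + ⟪q k, Θ x⟫ + ‖x - v k‖ ^ 2 / (2 * α))
    (hp : ∀ k, p (k + 1) = Pi (p k + γ • Θ (u (k + 1))))
    (hv : ∀ k, v (k + 1) = (1 - η) • u (k + 1) + η • v k)
    (hGmono : ∀ x ∈ U, ∀ y ∈ U, 0 ≤ ⟪G x - G y, x - y⟫)
    (r : ℝ) (hr : 0 < r)
    (hur : ∀ k : ℕ, 1 ≤ k → ‖u k‖ ≤ r) (hqr : ∀ k : ℕ, 1 ≤ k → ‖q k‖ ≤ r)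
    (ψ : EuclideanSpace ℝ (Fin n) → EuclideanSpace ℝ (Fin m) → ℝ)
    (hψ : ∀ x y, ψ x y = sSup {t : ℝ |
      ∃ ζ ∈ U ∩ Metric.closedBall 0 r, ∃ lam ∈ Cstar ∩ Metric.closedBall 0 r,
        t = ⟪G ζ, x - ζ⟫ + J x - J ζ + ⟪lam, Θ x⟫ - ⟪y, Θ ζ⟫}) :
    ∃ ρtilde : ℝ, 0 < ρtilde ∧ ∀ t : ℕ, 1 ≤ t →
      ψ ((t : ℝ)⁻¹ • ∑ k ∈ Finset.Icc 1 t, u k)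
        ((t : ℝ)⁻¹ • ∑ k ∈ Finset.Icc 1 t, q k) ≤ ρtilde / t := by
  have hη0 : 0 < η := by
    have : (1 : ℝ) < Real.sqrt 5 := by rw [Real.lt_sqrt] <;> norm_num
    linarith
  have hη : 1 ≤ η ^ 2 + η := by
    have h5 : Real.sqrt 5 ^ 2 = 5 := Real.sq_sqrt (by norm_num)
    have := Real.sqrt_nonneg 5
    nlinarith
  have hγτ : γ * τ ≤ 1 := ((lt_div_iff₀ hτ).1 hγ₂).le
  have hη1 : 0 < 1 - η := by linarith
  have huU' : ∀ k, u k ∈ U := fun k => by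
    cases k with
    | zero => exact hu0
    | succ k => exact huU k
  have hqC : ∀ k, q k ∈ Cstar := fun k => hq k ▸ (hPi _).1
  have hinner : ∀ l ∈ Cstar, ConvexOn ℝ Set.univ fun x => ⟪l, Θ x⟫ := fun l hl =>
    convexOn_inner_of_cone_convex hΘcx (by rw [hCstar] at hl; exact hl)
  have hprox : ∀ k, ∀ x ∈ U, ⟪G (u k), u (k + 1)⟫ + J (u (k + 1)) + ⟪q k, Θ (u (k + 1))⟫ -
      (⟪G (u k), x⟫ + J x + ⟪q k, Θ x⟫) ≤
      1 / (2 * α) * (‖x - v k‖ ^ 2 - ‖u (k + 1) - v k‖ ^ 2 - ‖x - u (k + 1)‖ ^ 2) := by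
    intro k x hx
    have hlin : ConvexOn ℝ Set.univ fun x => ⟪G (u k), x⟫ :=
      (innerₛₗ ℝ (G (u k))).convexOn convex_univ
    have hf := ((hlin.add hJ).add (hinner _ (hqC k))).subset (Set.subset_univ U) hUcx
    refine hf.three_point_inequality (v := v k) (huU k) (fun y hy => ?_) hx
    have := humin k y hy
    rw [one_div_mul_eq_div, one_div_mul_eq_div]
    exact this
  have hbudget : γ * τ ^ 2 + L + τ ≤ 1 / (2 * α) / η := by
    have hpos : 0 < 2 * (γ * τ ^ 2 + L + τ) * η := by positivity
    rw [le_div_iff₀ hpos] at hα₂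
    rw [div_div, le_div_iff₀ (by positivity)]
    linarith
  set e : EuclideanSpace ℝ (Fin n) → EuclideanSpace ℝ (Fin m) → ℕ → ℝ := fun ζ l k =>
    1 / (2 * α) * (‖ζ - v (k + 1)‖ ^ 2 / (1 - η)) + ‖l - p k‖ ^ 2 / (2 * γ) +
      (γ * τ ^ 2 + L) / 2 * ‖u (k + 1) - u k‖ ^ 2 with he
  have he0 : ∀ ζ l k, 0 ≤ e ζ l k := fun ζ l k => by
    simp only [he]; positivity
  have hstep : ∀ ζ ∈ U, ∀ l ∈ Cstar, ∀ k,
      ⟪G ζ, u (k + 1) - ζ⟫ + J (u (k + 1)) - J ζ + ⟪l, Θ (u (k + 1))⟫ - ⟪q (k + 1), Θ ζ⟫ ≤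
        e ζ l k - e ζ l (k + 1) := by
    intro ζ hζ l hl k
    have hA := hprox (k + 1) ζ hζ
    have hB := hprox k (u (k + 1 + 1)) (huU _)
    have hD := dual_step_inequality hPi hl (hp k) (hq (k + 1))
    have hgold := golden_ratio_step_inequality (x := ζ) hη0 hη₂ hη (hv k) (hv (k + 1))
    have hmono := hGmono _ (huU k) ζ hζ
    have hpq : ‖p (k + 1) - q k‖ ≤ γ * τ * ‖u (k + 1) - u k‖ := by
      rw [hp k, hq k]
      refine (norm_sub_le_of_variational_inequality hPi _ _).trans ?_
      rw [add_sub_add_left_eq_sub, ← smul_sub, norm_smul, Real.norm_of_nonneg hγ₁.le, mul_assoc]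
      exact mul_le_mul_of_nonneg_left (hΘLip _ _) hγ₁.le
    have hqq : ‖q k - q (k + 1)‖ ≤ ‖p (k + 1) - q (k + 1)‖ + γ * τ * ‖u (k + 1) - u k‖ := by
      have := norm_sub_le_norm_sub_add_norm_sub (q k) (p (k + 1)) (q (k + 1))
      rw [norm_sub_rev (q k) (p (k + 1))] at this
      linarith
    have hS : ⟪q k - q (k + 1), Θ (u (k + 1 + 1)) - Θ (u (k + 1))⟫ ≤
        (‖p (k + 1) - q (k + 1)‖ + γ * τ * ‖u (k + 1) - u k‖) *
          (τ * ‖u (k + 1 + 1) - u (k + 1)‖) :=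
      (real_inner_le_norm _ _).trans
        (mul_le_mul hqq (hΘLip _ _) (norm_nonneg _) ((norm_nonneg _).trans hqq))
    have hE : ⟪G (u k) - G (u (k + 1)), u (k + 1 + 1) - u (k + 1)⟫ ≤
        L * ‖u (k + 1) - u k‖ * ‖u (k + 1 + 1) - u (k + 1)‖ := by
      refine (real_inner_le_norm _ _).trans (mul_le_mul_of_nonneg_right ?_ (norm_nonneg _))
      rw [norm_sub_rev (u (k + 1))]
      exact hGLip _ (huU' k) _ (huU k)
    have hC := coupling_terms_le hγ₁ hτ hL hγτ hS hE
    have hgold' := mul_le_mul_of_nonneg_left hgold (by positivity : 0 ≤ 1 / (2 * α))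
    have hb := mul_le_mul_of_nonneg_right hbudget (sq_nonneg ‖u (k + 1 + 1) - u (k + 1)‖)
    have hD' : ⟪l - q (k + 1), Θ (u (k + 1))⟫ ≤ ‖l - p k‖ ^ 2 / (2 * γ) -
        ‖l - p (k + 1)‖ ^ 2 / (2 * γ) - ‖p (k + 1) - q (k + 1)‖ ^ 2 / γ := by
      refine le_of_mul_le_mul_left (hD.trans_eq ?_) hγ₁
      field_simp
    have hg : 1 / (2 * α) * (‖u (k + 1 + 1) - u (k + 1)‖ ^ 2 / η) =
        1 / (2 * α) / η * ‖u (k + 1 + 1) - u (k + 1)‖ ^ 2 := by ring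
    simp only [he]
    simp only [inner_sub_left, inner_sub_right] at hmono hC hD' ⊢
    rw [mul_add, sub_div, mul_sub _ (_ - _) (_ / η), mul_sub _ (_ / (1 - η)), hg] at hgold'
    linarith
  refine ⟨1 / (2 * α) * ((r + ‖v 1‖) ^ 2 / (1 - η)) + (r + ‖p 0‖) ^ 2 / (2 * γ) +
      (γ * τ ^ 2 + L) / 2 * ‖u 1 - u 0‖ ^ 2, by positivity, fun t ht => ?_⟩
  rw [hψ]
  refine Real.sSup_le ?_ (by positivity)
  rintro _ ⟨ζ, ⟨hζ, hζr⟩, l, ⟨hl, hlr⟩, rfl⟩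
  rw [mem_closedBall_zero_iff] at hζr hlr
  have ht0 : (t : ℝ) ≠ 0 := by positivity
  have hsum := sum_Icc_le_of_le_sub (f := fun k => ⟪G ζ, u k - ζ⟫ + J (u k) - J ζ +
    ⟪l, Θ (u k)⟫ - ⟪q k, Θ ζ⟫) (hstep ζ hζ l hl) (he0 ζ l) t
  have hJt := hJ.map_Icc_average_le u ht
  have hΘt := (hinner l hl).map_Icc_average_le u ht
  have he_le : e ζ l 0 ≤ 1 / (2 * α) * ((r + ‖v 1‖) ^ 2 / (1 - η)) +
      (r + ‖p 0‖) ^ 2 / (2 * γ) + (γ * τ ^ 2 + L) / 2 * ‖u 1 - u 0‖ ^ 2 := by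
    have h1 : ‖ζ - v 1‖ ≤ r + ‖v 1‖ := (norm_sub_le _ _).trans (by linarith)
    have h2 : ‖l - p 0‖ ≤ r + ‖p 0‖ := (norm_sub_le _ _).trans (by linarith)
    simp only [he, zero_add]
    gcongr
  have hmean := mul_le_mul_of_nonneg_left (hsum.trans he_le)
    (by positivity : 0 ≤ (t : ℝ)⁻¹)
  simp only [inner_sub_right, Finset.sum_add_distrib, Finset.sum_sub_distrib, Finset.sum_const,
    Nat.card_Icc, Nat.add_sub_cancel, nsmul_eq_mul] at hmean
  simp only [mul_add, mul_sub, inv_mul_cancel_left₀ ht0] at hmean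
  rw [inner_sub_right, real_inner_smul_right, inner_sum, real_inner_smul_left, sum_inner,
    div_eq_inv_mul, mul_add, mul_add]
  linarith
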